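/- arXiv:2102.10360 — 2 statements merged into one kernel-verified Lean document; each statement's English description precedes it below -/
import Mathlib

section
/- Let u be a smooth function on the closed unit ball of ℝ⁴ satisfying Δ²u(x) ≥ 6·e^{4u(x)} for all x in the open unit ball B₁, and on the unit sphere ∂B₁ satisfying u = 0, ∂_ν u = −1, and Δu ≤ −3. Then u(x) = ln(2/(1+|x|²)) for all x in the closed unit ball. -/
open Metric Real

/-- The Euclidean Laplacian of a function on `ℝⁿ`, as the sum of pure second
derivatives in the coordinate directions. -/
noncomputable def laplacian {n : ℕ} (u : EuclideanSpace ℝ (Fin n) → ℝ)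
    (x : EuclideanSpace ℝ (Fin n)) : ℝ :=
  ∑ i : Fin n, iteratedFDeriv ℝ 2 u x ![EuclideanSpace.single i 1, EuclideanSpace.single i 1]

open MeasureTheory
open scoped ContDiff

/-- The partial derivative of a function on `ℝⁿ` in the `i`-th coordinate direction. -/
noncomputable def partialDeriv {n : ℕ} (i : Fin n) (f : EuclideanSpace ℝ (Fin n) → ℝ)
    (x : EuclideanSpace ℝ (Fin n)) : ℝ :=
  fderiv ℝ f x (EuclideanSpace.single i 1)

section Calculus

variable {n : ℕ} {f g : EuclideanSpace ℝ (Fin n) → ℝ}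

theorem ContDiff.partialDeriv (hf : ContDiff ℝ ∞ f) (i : Fin n) :
    ContDiff ℝ ∞ (partialDeriv i f) :=
  (hf.fderiv_right (by simp)).clm_apply contDiff_const

theorem laplacian_eq_sum_partialDeriv (hf : ContDiff ℝ ∞ f) (x : EuclideanSpace ℝ (Fin n)) :
    laplacian f x = ∑ i, partialDeriv i (partialDeriv i f) x := by
  refine Finset.sum_congr rfl fun i _ => ?_
  have hd : DifferentiableAt ℝ (fderiv ℝ f) x :=
    ((hf.fderiv_right (m := ∞) (by simp)).differentiable (by simp)) x
  rw [iteratedFDeriv_two_apply]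
  unfold _root_.partialDeriv
  rw [fderiv_clm_apply hd (differentiableAt_const _)]
  simp

theorem ContDiff.laplacian (hf : ContDiff ℝ ∞ f) : ContDiff ℝ ∞ (laplacian f) := by
  rw [funext (laplacian_eq_sum_partialDeriv hf)]
  exact ContDiff.sum fun i _ => (hf.partialDeriv i).partialDeriv i

theorem partialDeriv_mul (hf : ContDiff ℝ ∞ f) (hg : ContDiff ℝ ∞ g) (i : Fin n)
    (x : EuclideanSpace ℝ (Fin n)) :
    partialDeriv i (fun y => f y * g y) x = f x * partialDeriv i g x + g x * partialDeriv i f x := by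
  unfold partialDeriv
  rw [fderiv_fun_mul (hf.differentiable (by simp) x) (hg.differentiable (by simp) x)]
  simp

theorem partialDeriv_sub (hf : ContDiff ℝ ∞ f) (hg : ContDiff ℝ ∞ g) (i : Fin n)
    (x : EuclideanSpace ℝ (Fin n)) :
    partialDeriv i (fun y => f y - g y) x = partialDeriv i f x - partialDeriv i g x := by
  unfold partialDeriv
  rw [fderiv_fun_sub (hf.differentiable (by simp) x) (hg.differentiable (by simp) x)]
  simp

theorem partialDeriv_add (hf : ContDiff ℝ ∞ f) (hg : ContDiff ℝ ∞ g) (i : Fin n)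
    (x : EuclideanSpace ℝ (Fin n)) :
    partialDeriv i (fun y => f y + g y) x = partialDeriv i f x + partialDeriv i g x := by
  unfold partialDeriv
  rw [fderiv_fun_add (hf.differentiable (by simp) x) (hg.differentiable (by simp) x)]
  simp

theorem laplacian_sub (hf : ContDiff ℝ ∞ f) (hg : ContDiff ℝ ∞ g)
    (x : EuclideanSpace ℝ (Fin n)) :
    laplacian (fun y => f y - g y) x = laplacian f x - laplacian g x := by
  rw [laplacian_eq_sum_partialDeriv (hf.sub hg), laplacian_eq_sum_partialDeriv hf,
    laplacian_eq_sum_partialDeriv hg, ← Finset.sum_sub_distrib]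
  refine Finset.sum_congr rfl fun i _ => ?_
  rw [funext (partialDeriv_sub hf hg i),
    partialDeriv_sub (hf.partialDeriv i) (hg.partialDeriv i)]

theorem hasFDerivAt_comp_norm_sq {h : ℝ → ℝ} {h' : ℝ} {x : EuclideanSpace ℝ (Fin n)}
    (hh : HasDerivAt h h' (‖x‖ ^ 2)) :
    HasFDerivAt (fun y : EuclideanSpace ℝ (Fin n) => h (‖y‖ ^ 2))
      (h' • (2 • innerSL ℝ x)) x :=
  hh.comp_hasFDerivAt x (hasStrictFDerivAt_norm_sq x).hasFDerivAt

theorem partialDeriv_comp_norm_sq {h : ℝ → ℝ} {h' : ℝ} {x : EuclideanSpace ℝ (Fin n)}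
    (hh : HasDerivAt h h' (‖x‖ ^ 2)) (i : Fin n) :
    partialDeriv i (fun y => h (‖y‖ ^ 2)) x = 2 * h' * x i := by
  unfold partialDeriv
  rw [(hasFDerivAt_comp_norm_sq hh).fderiv]
  simp [EuclideanSpace.inner_single_right]
  ring

/-- The Laplacian of a radial function, written in the variable `‖x‖ ^ 2`. -/
theorem laplacian_comp_norm_sq {h h₁ h₂ : ℝ → ℝ}
    (hf : ContDiff ℝ ∞ fun y : EuclideanSpace ℝ (Fin n) => h (‖y‖ ^ 2))
    (hh : ∀ s, 0 ≤ s → HasDerivAt h (h₁ s) s) (hh₁ : ∀ s, 0 ≤ s → HasDerivAt h₁ (h₂ s) s)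
    (x : EuclideanSpace ℝ (Fin n)) :
    laplacian (fun y => h (‖y‖ ^ 2)) x
      = 4 * ‖x‖ ^ 2 * h₂ (‖x‖ ^ 2) + 2 * n * h₁ (‖x‖ ^ 2) := by
  rw [laplacian_eq_sum_partialDeriv hf]
  have key : ∀ i : Fin n, partialDeriv i (partialDeriv i fun y => h (‖y‖ ^ 2)) x
      = 4 * h₂ (‖x‖ ^ 2) * x i ^ 2 + 2 * h₁ (‖x‖ ^ 2) := by
    intro i
    rw [funext fun y => partialDeriv_comp_norm_sq (hh _ (sq_nonneg ‖y‖)) i]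
    have h1 := (hasFDerivAt_comp_norm_sq (hh₁ _ (sq_nonneg ‖x‖))).const_mul 2
    have h2 : HasFDerivAt (fun y : EuclideanSpace ℝ (Fin n) => y i)
        (EuclideanSpace.proj i : EuclideanSpace ℝ (Fin n) →L[ℝ] ℝ) x :=
      (EuclideanSpace.proj i : EuclideanSpace ℝ (Fin n) →L[ℝ] ℝ).hasFDerivAt
    unfold partialDeriv
    rw [(h1.fun_mul h2).fderiv]
    simp [EuclideanSpace.inner_single_right]
    ring
  rw [Finset.sum_congr rfl fun i _ => key i, Finset.sum_add_distrib, ← Finset.mul_sum,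
    EuclideanSpace.real_norm_sq_eq]
  simp
  ring

end Calculus

/-- A function vanishing on the unit sphere whose normal derivative vanishes there has zero
gradient on the unit sphere. -/
theorem fderiv_eq_zero_of_sphere {E : Type*} [NormedAddCommGroup E] [InnerProductSpace ℝ E]
    {f : E → ℝ} (hf : Differentiable ℝ f)
    (h0 : ∀ x ∈ sphere (0 : E) 1, f x = 0) (h1 : ∀ x ∈ sphere (0 : E) 1, fderiv ℝ f x x = 0)
    {x : E} (hx : x ∈ sphere (0 : E) 1) : fderiv ℝ f x = 0 := by
  have hx1 : ‖x‖ = 1 := by simpa using hx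
  have tangential : ∀ y : E, ‖y‖ = 1 → inner ℝ x y = 0 → fderiv ℝ f x y = 0 := by
    intro y hy hxy
    have hc : HasDerivAt (fun t : ℝ => cos t • x + sin t • y) y 0 := by
      have := ((hasDerivAt_cos 0).smul_const x).fun_add ((hasDerivAt_sin 0).smul_const y)
      simpa using this
    have hfx : HasFDerivAt f (fderiv ℝ f x) (cos 0 • x + sin 0 • y) := by
      simpa using (hf x).hasFDerivAt
    have hcomp := hfx.comp_hasDerivAt (0 : ℝ) hc
    have hzero : (f ∘ fun t : ℝ => cos t • x + sin t • y) = fun _ => 0 := by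
      funext t
      refine h0 _ ?_
      have : ‖cos t • x + sin t • y‖ ^ 2 = 1 := by
        rw [norm_add_sq_real, norm_smul, norm_smul, real_inner_smul_left, real_inner_smul_right,
          hxy, hx1, hy]
        simp
      rw [mem_sphere_zero_iff_norm]
      nlinarith [norm_nonneg (cos t • x + sin t • y)]
    rw [hzero] at hcomp
    exact hcomp.unique (hasDerivAt_const 0 0)
  ext z
  set p := z - inner ℝ x z • x with hp
  have hxp : inner ℝ x p = 0 := by
    rw [hp, inner_sub_right, real_inner_smul_right, real_inner_self_eq_norm_sq, hx1]
    simp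
  have hfp : fderiv ℝ f x p = 0 := by
    rcases eq_or_ne p 0 with h | h
    · rw [h, map_zero]
    · have hn : ‖p‖ ≠ 0 := norm_ne_zero_iff.mpr h
      have := tangential (‖p‖⁻¹ • p) (by rw [norm_smul, norm_inv, norm_norm, inv_mul_cancel₀ hn])
        (by rw [real_inner_smul_right, hxp, mul_zero])
      rw [map_smul, smul_eq_mul] at this
      exact (mul_eq_zero.mp this).resolve_left (inv_ne_zero hn)
  rw [hp, map_sub, map_smul, h1 x hx, smul_zero, sub_zero] at hfp
  simpa using hfp

section Divergence

variable {n : ℕ}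

/-- The one-variable case: integration along a line cut out by the unit ball. -/
theorem integral_deriv_sq_lt_nonpos {G G' : ℝ → ℝ} {c : ℝ}
    (hG : ∀ t, HasDerivAt G (G' t) t) (hG' : Continuous G')
    (hb : ∀ t, t ^ 2 = c → G t * t ≤ 0) :
    ∫ t in {t : ℝ | t ^ 2 < c}, G' t ≤ 0 := by
  rcases le_or_gt c 0 with hc | hc
  · have : {t : ℝ | t ^ 2 < c} = ∅ := by
      ext t
      simpa using hc.trans (sq_nonneg t)
    simp [this]
  · have hs : 0 < √c := sqrt_pos.mpr hc
    have hset : {t : ℝ | t ^ 2 < c} = Set.Ioo (-√c) (√c) := by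
      ext t
      simp [Real.sq_lt]
    rw [hset, ← integral_Ioc_eq_integral_Ioo, ← intervalIntegral.integral_of_le (by linarith),
      intervalIntegral.integral_eq_sub_of_hasDerivAt (fun t _ => hG t)
        (hG'.intervalIntegrable _ _)]
    have h1 := hb (√c) (sq_sqrt hc.le)
    have h2 := hb (-√c) (by rw [neg_sq, sq_sqrt hc.le])
    have h3 : G (√c) ≤ 0 := by by_contra! h; nlinarith
    have h4 : 0 ≤ G (-√c) := by by_contra! h; nlinarith
    linarith

/-- The divergence theorem on the unit ball for a field along one coordinate axis, as a sign
statement. -/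
theorem setIntegral_partialDeriv_ball_nonpos {F : EuclideanSpace ℝ (Fin (n + 1)) → ℝ}
    (hF : ContDiff ℝ ∞ F) (i : Fin (n + 1))
    (hb : ∀ x ∈ sphere (0 : EuclideanSpace ℝ (Fin (n + 1))) 1, F x * x i ≤ 0) :
    ∫ x in ball (0 : EuclideanSpace ℝ (Fin (n + 1))) 1, partialDeriv i F x ≤ 0 := by
  have hcont : Continuous (partialDeriv i F) := (hF.partialDeriv i).continuous
  let e : ℝ × (Fin n → ℝ) ≃ᵐ EuclideanSpace ℝ (Fin (n + 1)) :=
    (MeasurableEquiv.piFinSuccAbove (fun _ => ℝ) i).symm.trans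
      (MeasurableEquiv.toLp 2 (Fin (n + 1) → ℝ))
  have he : MeasurePreserving e volume volume :=
    (PiLp.volume_preserving_toLp (Fin (n + 1))).comp
      (volume_preserving_piFinSuccAbove (fun _ => ℝ) i).symm
  have heq : ∀ t y, e (t, y) = WithLp.toLp 2 (i.insertNth t y) := fun _ _ => rfl
  have hnorm : ∀ t y, ‖e (t, y)‖ ^ 2 = t ^ 2 + ∑ j, y j ^ 2 := by
    intro t y
    rw [EuclideanSpace.real_norm_sq_eq, Fin.sum_univ_succAbove _ i]
    simp [heq]
  have hline : ∀ t y, e (t, y) = e (0, y) + t • EuclideanSpace.single i 1 := by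
    intro t y
    ext j
    rcases Fin.eq_self_or_eq_succAbove i j with rfl | ⟨k, rfl⟩ <;> simp [heq]
  have hint : IntegrableOn (partialDeriv i F) (ball 0 1) :=
    (hcont.continuousOn.integrableOn_compact (isCompact_closedBall 0 1)).mono_set
      ball_subset_closedBall
  rw [← integral_indicator measurableSet_ball, ← he.integral_comp']
  have hint' : Integrable (fun p => (ball 0 1).indicator (partialDeriv i F) (e p))
      ((volume : Measure ℝ).prod volume) :=
    he.integrable_comp_of_integrable (hint.integrable_indicator measurableSet_ball)
  change ∫ p, _ ∂((volume : Measure ℝ).prod volume) ≤ 0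
  rw [integral_prod_symm _ hint']
  refine integral_nonpos fun y => ?_
  have hsec : (fun t => (ball 0 1).indicator (partialDeriv i F) (e (t, y)))
      = {t : ℝ | t ^ 2 < 1 - ∑ j, y j ^ 2}.indicator fun t => partialDeriv i F (e (t, y)) := by
    funext t
    have : e (t, y) ∈ ball 0 1 ↔ t ^ 2 < 1 - ∑ j, y j ^ 2 := by
      rw [mem_ball_zero_iff, ← sq_lt_one_iff₀ (norm_nonneg _), hnorm, lt_sub_iff_add_lt]
    simp only [Set.indicator, this, Set.mem_ofPred_eq]
  have hmeas : MeasurableSet {t : ℝ | t ^ 2 < 1 - ∑ j, y j ^ 2} :=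
    (isOpen_lt (by fun_prop) continuous_const).measurableSet
  have hder : ∀ t, HasDerivAt (fun t => e (t, y)) (EuclideanSpace.single i 1) t := by
    intro t
    rw [funext fun t => hline t y]
    simpa using ((hasDerivAt_id t).smul_const (EuclideanSpace.single i (1 : ℝ))).const_add
      (e (0, y))
  change ∫ t, (ball 0 1).indicator (partialDeriv i F) (e (t, y)) ≤ 0
  rw [hsec, integral_indicator hmeas]
  refine integral_deriv_sq_lt_nonpos (G := fun t => F (e (t, y))) (fun t => ?_) ?_ fun t ht => ?_
  · exact ((hF.differentiable (by simp)) (e (t, y))).hasFDerivAt.comp_hasDerivAt t (hder t)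
  · exact hcont.comp (continuous_iff_continuousAt.mpr fun t => (hder t).continuousAt)
  · have hmem : e (t, y) ∈ sphere 0 1 := by
      rw [mem_sphere_zero_iff_norm, ← pow_eq_one_iff_of_nonneg (norm_nonneg _) two_ne_zero, hnorm,
        ht]
      ring
    simpa [heq] using hb _ hmem

end Divergence

/-- Green's second identity for the bi-Laplacian on the unit ball, as an inequality: the only
boundary term left is the one pairing `Δv ≤ 0` with the inward gradient of `φ`. -/
theorem setIntegral_bilaplacian_green_nonpos {n : ℕ} {v φ : EuclideanSpace ℝ (Fin (n + 1)) → ℝ}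
    (hv : ContDiff ℝ ∞ v) (hφ : ContDiff ℝ ∞ φ)
    (hv0 : ∀ x ∈ sphere (0 : EuclideanSpace ℝ (Fin (n + 1))) 1, v x = 0)
    (hv1 : ∀ x ∈ sphere (0 : EuclideanSpace ℝ (Fin (n + 1))) 1, fderiv ℝ v x x = 0)
    (hv2 : ∀ x ∈ sphere (0 : EuclideanSpace ℝ (Fin (n + 1))) 1, laplacian v x ≤ 0)
    (hφ0 : ∀ x ∈ sphere (0 : EuclideanSpace ℝ (Fin (n + 1))) 1, φ x = 0)
    (hφ1 : ∀ x ∈ sphere (0 : EuclideanSpace ℝ (Fin (n + 1))) 1, ∀ i,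
      partialDeriv i φ x * x i ≤ 0) :
    ∫ x in ball (0 : EuclideanSpace ℝ (Fin (n + 1))) 1,
      (φ x * laplacian (laplacian v) x - v x * laplacian (laplacian φ) x) ≤ 0 := by
  have hΔv := hv.laplacian
  have hΔφ := hφ.laplacian
  let F : Fin (n + 1) → EuclideanSpace ℝ (Fin (n + 1)) → ℝ := fun i x =>
    (φ x * partialDeriv i (laplacian v) x - laplacian v x * partialDeriv i φ x)
      + (laplacian φ x * partialDeriv i v x - v x * partialDeriv i (laplacian φ) x)
  have hF : ∀ i, ContDiff ℝ ∞ (F i) := fun i =>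
    ((hφ.mul (hΔv.partialDeriv i)).sub (hΔv.mul (hφ.partialDeriv i))).add
      ((hΔφ.mul (hv.partialDeriv i)).sub (hv.mul (hΔφ.partialDeriv i)))
  have hdiv : ∀ x, φ x * laplacian (laplacian v) x - v x * laplacian (laplacian φ) x
      = ∑ i, partialDeriv i (F i) x := by
    intro x
    have hFi : ∀ i, partialDeriv i (F i) x
        = φ x * partialDeriv i (partialDeriv i (laplacian v)) x
          - laplacian v x * partialDeriv i (partialDeriv i φ) x
          + laplacian φ x * partialDeriv i (partialDeriv i v) x
          - v x * partialDeriv i (partialDeriv i (laplacian φ)) x := by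
      intro i
      rw [partialDeriv_add ((hφ.mul (hΔv.partialDeriv i)).sub (hΔv.mul (hφ.partialDeriv i)))
          ((hΔφ.mul (hv.partialDeriv i)).sub (hv.mul (hΔφ.partialDeriv i))),
        partialDeriv_sub (hφ.mul (hΔv.partialDeriv i)) (hΔv.mul (hφ.partialDeriv i)),
        partialDeriv_sub (hΔφ.mul (hv.partialDeriv i)) (hv.mul (hΔφ.partialDeriv i)),
        partialDeriv_mul hφ (hΔv.partialDeriv i), partialDeriv_mul hΔv (hφ.partialDeriv i),
        partialDeriv_mul hΔφ (hv.partialDeriv i), partialDeriv_mul hv (hΔφ.partialDeriv i)]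
      ring
    rw [Finset.sum_congr rfl fun i _ => hFi i, Finset.sum_sub_distrib, Finset.sum_add_distrib,
      Finset.sum_sub_distrib, ← Finset.mul_sum, ← Finset.mul_sum, ← Finset.mul_sum,
      ← Finset.mul_sum, ← laplacian_eq_sum_partialDeriv hΔv, ← laplacian_eq_sum_partialDeriv hφ,
      ← laplacian_eq_sum_partialDeriv hv, ← laplacian_eq_sum_partialDeriv hΔφ]
    ring
  simp_rw [hdiv]
  rw [integral_finsetSum _ fun i _ =>
    (((hF i).partialDeriv i).continuous.continuousOn.integrableOn_compact
      (isCompact_closedBall 0 1)).mono_set ball_subset_closedBall]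
  refine Finset.sum_nonpos fun i _ => setIntegral_partialDeriv_ball_nonpos (hF i) i fun x hx => ?_
  have hgrad : partialDeriv i v x = 0 := by
    rw [partialDeriv, fderiv_eq_zero_of_sphere (hv.differentiable (by simp)) hv0 hv1 hx]
    simp
  simp only [F, hφ0 x hx, hv0 x hx, hgrad]
  nlinarith [mul_nonneg_of_nonpos_of_nonpos (hv2 x hx) (hφ1 x hx i)]

section Profiles

/-- The logarithm of the conformal factor of the round hemisphere. -/
noncomputable def hemisphereFactor (x : EuclideanSpace ℝ (Fin 4)) : ℝ :=
  log 2 - log (1 + ‖x‖ ^ 2)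

/-- The height function of the hemisphere in stereographic coordinates. -/
noncomputable def hemisphereHeight (x : EuclideanSpace ℝ (Fin 4)) : ℝ :=
  2 * (1 + ‖x‖ ^ 2)⁻¹ - 1

theorem hasDerivAt_inv_one_add_pow (k : ℕ) {s : ℝ} (hs : 0 ≤ s) :
    HasDerivAt (fun s : ℝ => (1 + s)⁻¹ ^ k) (-k * (1 + s)⁻¹ ^ (k + 1)) s := by
  have h0 : (1 + s) ≠ 0 := by positivity
  have h := (((hasDerivAt_id s).const_add 1).fun_inv h0).fun_pow k
  refine h.congr_deriv ?_
  rcases k with _ | k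
  · simp
  · simp
    field_simp
    ring

theorem contDiff_hemisphereFactor : ContDiff ℝ ∞ hemisphereFactor :=
  contDiff_const.sub ((contDiff_const.add (contDiff_norm_sq ℝ)).log fun x => by positivity)

theorem contDiff_hemisphereHeight : ContDiff ℝ ∞ hemisphereHeight :=
  (contDiff_const.mul ((contDiff_const.add (contDiff_norm_sq ℝ)).inv fun x => by positivity)).sub
    contDiff_const

theorem laplacian_cubic_inv_one_add_norm_sq (a b c d : ℝ) (x : EuclideanSpace ℝ (Fin 4)) :
    laplacian (fun y => d + a * (1 + ‖y‖ ^ 2)⁻¹ ^ 1 + b * (1 + ‖y‖ ^ 2)⁻¹ ^ 2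
        + c * (1 + ‖y‖ ^ 2)⁻¹ ^ 3) x
      = 8 * (b - a) * (1 + ‖x‖ ^ 2)⁻¹ ^ 3 + 24 * (c - b) * (1 + ‖x‖ ^ 2)⁻¹ ^ 4
        - 48 * c * (1 + ‖x‖ ^ 2)⁻¹ ^ 5 := by
  have hpow (k : ℕ) : ContDiff ℝ ∞ fun x : EuclideanSpace ℝ (Fin 4) => (1 + ‖x‖ ^ 2)⁻¹ ^ k :=
    ((contDiff_const.add (contDiff_norm_sq ℝ)).inv fun x => by positivity).pow k
  rw [laplacian_comp_norm_sq
    (h := fun s => d + a * (1 + s)⁻¹ ^ 1 + b * (1 + s)⁻¹ ^ 2 + c * (1 + s)⁻¹ ^ 3)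
    (h₁ := fun s => -a * (1 + s)⁻¹ ^ 2 + -2 * b * (1 + s)⁻¹ ^ 3 + -3 * c * (1 + s)⁻¹ ^ 4)
    (h₂ := fun s => 2 * a * (1 + s)⁻¹ ^ 3 + 6 * b * (1 + s)⁻¹ ^ 4 + 12 * c * (1 + s)⁻¹ ^ 5)
    (((contDiff_const.add (contDiff_const.mul (hpow 1))).add
      (contDiff_const.mul (hpow 2))).add (contDiff_const.mul (hpow 3)))
    (fun s hs => ?_) fun s hs => ?_]
  · have h0 : 1 + ‖x‖ ^ 2 ≠ 0 := by positivity
    push_cast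
    field_simp
    ring
  · refine (((((hasDerivAt_inv_one_add_pow 1 hs).const_mul a).const_add d).fun_add
      ((hasDerivAt_inv_one_add_pow 2 hs).const_mul b)).fun_add
      ((hasDerivAt_inv_one_add_pow 3 hs).const_mul c)).congr_deriv ?_
    push_cast
    ring
  · refine ((((hasDerivAt_inv_one_add_pow 2 hs).const_mul (-a)).fun_add
      ((hasDerivAt_inv_one_add_pow 3 hs).const_mul (-2 * b))).fun_add
      ((hasDerivAt_inv_one_add_pow 4 hs).const_mul (-3 * c))).congr_deriv ?_
    push_cast
    ring

theorem hasDerivAt_hemisphereFactor_profile {s : ℝ} (hs : 0 ≤ s) :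
    HasDerivAt (fun s => log 2 - log (1 + s)) (-1 * (1 + s)⁻¹ ^ 1) s := by
  refine ((((hasDerivAt_id s).const_add 1).log
    (by simpa using (by positivity : 1 + s ≠ 0))).const_sub (log 2)).congr_deriv ?_
  simp [div_eq_mul_inv]

theorem laplacian_hemisphereFactor (x : EuclideanSpace ℝ (Fin 4)) :
    laplacian hemisphereFactor x
      = 0 + -4 * (1 + ‖x‖ ^ 2)⁻¹ ^ 1 + -4 * (1 + ‖x‖ ^ 2)⁻¹ ^ 2 + 0 * (1 + ‖x‖ ^ 2)⁻¹ ^ 3 := by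
  have h0 : 1 + ‖x‖ ^ 2 ≠ 0 := by positivity
  unfold hemisphereFactor
  rw [laplacian_comp_norm_sq (h := fun s => log 2 - log (1 + s))
    (h₂ := fun s => -1 * (-(1 : ℕ) * (1 + s)⁻¹ ^ 2))
    contDiff_hemisphereFactor (fun s hs => hasDerivAt_hemisphereFactor_profile hs)
    fun s hs => (hasDerivAt_inv_one_add_pow 1 hs).const_mul (-1)]
  push_cast
  field_simp
  ring

theorem bilaplacian_hemisphereFactor (x : EuclideanSpace ℝ (Fin 4)) :
    laplacian (laplacian hemisphereFactor) x = 6 * exp (4 * hemisphereFactor x) := by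
  have h0 : 0 < 1 + ‖x‖ ^ 2 := by positivity
  have he : exp (4 * hemisphereFactor x) = (2 / (1 + ‖x‖ ^ 2)) ^ 4 := by
    rw [hemisphereFactor, ← log_div two_ne_zero h0.ne', show (4 : ℝ) = (4 : ℕ) by norm_num,
      exp_nat_mul, exp_log (by positivity)]
  rw [funext laplacian_hemisphereFactor, laplacian_cubic_inv_one_add_norm_sq, he]
  field_simp
  ring

theorem laplacian_hemisphereHeight (x : EuclideanSpace ℝ (Fin 4)) :
    laplacian hemisphereHeight x
      = 0 + 0 * (1 + ‖x‖ ^ 2)⁻¹ ^ 1 + 0 * (1 + ‖x‖ ^ 2)⁻¹ ^ 2 + -16 * (1 + ‖x‖ ^ 2)⁻¹ ^ 3 := by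
  have h : hemisphereHeight = fun y => -1 + 2 * (1 + ‖y‖ ^ 2)⁻¹ ^ 1 + 0 * (1 + ‖y‖ ^ 2)⁻¹ ^ 2
      + 0 * (1 + ‖y‖ ^ 2)⁻¹ ^ 3 := by
    funext y
    rw [hemisphereHeight]
    ring
  rw [h, laplacian_cubic_inv_one_add_norm_sq]
  ring

/-- The height function lies in the kernel of the bi-Laplacian equation linearized at the round
hemisphere. -/
theorem bilaplacian_hemisphereHeight (x : EuclideanSpace ℝ (Fin 4)) :
    laplacian (laplacian hemisphereHeight) x
      = 4 * laplacian (laplacian hemisphereFactor) x * hemisphereHeight x := by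
  rw [funext laplacian_hemisphereHeight, funext laplacian_hemisphereFactor,
    laplacian_cubic_inv_one_add_norm_sq, laplacian_cubic_inv_one_add_norm_sq, hemisphereHeight]
  ring

theorem hemisphereHeight_pos {x : EuclideanSpace ℝ (Fin 4)} (hx : x ∈ ball 0 1) :
    0 < hemisphereHeight x := by
  have h1 : ‖x‖ ^ 2 < 1 := (sq_lt_one_iff₀ (norm_nonneg x)).mpr (mem_ball_zero_iff.mp hx)
  rw [hemisphereHeight, sub_pos, ← div_eq_mul_inv, one_lt_div (by positivity)]
  linarith

theorem partialDeriv_hemisphereHeight_mul_nonpos (x : EuclideanSpace ℝ (Fin 4)) (i : Fin 4) :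
    partialDeriv i hemisphereHeight x * x i ≤ 0 := by
  have hd : HasDerivAt (fun s : ℝ => 2 * (1 + s)⁻¹ - 1) (-2 * (1 + ‖x‖ ^ 2)⁻¹ ^ 2) (‖x‖ ^ 2) := by
    have := ((hasDerivAt_inv_one_add_pow 1 (sq_nonneg ‖x‖)).const_mul 2).sub_const 1
    simp only [pow_one] at this
    exact this.congr_deriv (by push_cast; ring)
  unfold hemisphereHeight
  rw [partialDeriv_comp_norm_sq hd i]
  have : 0 ≤ (1 + ‖x‖ ^ 2)⁻¹ ^ 2 * x i ^ 2 := by positivity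
  linarith

theorem fderiv_hemisphereFactor_self {x : EuclideanSpace ℝ (Fin 4)} (hx : x ∈ sphere 0 1) :
    fderiv ℝ hemisphereFactor x x = -1 := by
  have h1 : ‖x‖ = 1 := mem_sphere_zero_iff_norm.mp hx
  unfold hemisphereFactor
  rw [(hasFDerivAt_comp_norm_sq (hasDerivAt_hemisphereFactor_profile (sq_nonneg ‖x‖))).fderiv]
  simp [h1]
  norm_num

end Profiles

/-- Hemisphere rigidity, analytic form, `n = 4` (Theorem A of the paper). -/
theorem stmt_1 (u : EuclideanSpace ℝ (Fin 4) → ℝ) (hu : ContDiff ℝ (⊤ : ℕ∞) u)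
    (hineq : ∀ x ∈ ball (0 : EuclideanSpace ℝ (Fin 4)) 1,
      laplacian (laplacian u) x ≥ 6 * Real.exp (4 * u x))
    (hbd : ∀ x ∈ sphere (0 : EuclideanSpace ℝ (Fin 4)) 1, u x = 0)
    (hnu : ∀ x ∈ sphere (0 : EuclideanSpace ℝ (Fin 4)) 1, fderiv ℝ u x x = -1)
    (hlap : ∀ x ∈ sphere (0 : EuclideanSpace ℝ (Fin 4)) 1, laplacian u x ≤ -3) :
    ∀ x ∈ closedBall (0 : EuclideanSpace ℝ (Fin 4)) 1,
      u x = Real.log (2 / (1 + ‖x‖ ^ 2)) := by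
  set v : EuclideanSpace ℝ (Fin 4) → ℝ := fun x => u x - hemisphereFactor x with hv_def
  have hw := contDiff_hemisphereFactor
  have hφ := contDiff_hemisphereHeight
  have hv : ContDiff ℝ ∞ v := hu.sub hw
  have hΔv : laplacian v = fun x => laplacian u x - laplacian hemisphereFactor x :=
    funext (laplacian_sub hu hw)
  have hΔΔv : ∀ x, laplacian (laplacian v) x
      = laplacian (laplacian u) x - laplacian (laplacian hemisphereFactor) x := by
    intro x
    rw [hΔv, laplacian_sub hu.laplacian hw.laplacian]
  have hsphere : ∀ x ∈ sphere (0 : EuclideanSpace ℝ (Fin 4)) 1, ‖x‖ = 1 := fun x hx =>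
    mem_sphere_zero_iff_norm.mp hx
  have hv0 : ∀ x ∈ sphere (0 : EuclideanSpace ℝ (Fin 4)) 1, v x = 0 := by
    intro x hx
    simp only [hv_def, hbd x hx, hemisphereFactor, hsphere x hx]
    norm_num
  have hgreen := setIntegral_bilaplacian_green_nonpos hv hφ hv0
    (fun x hx => by
      rw [hv_def, fderiv_fun_sub (hu.differentiable (by simp) x) (hw.differentiable (by simp) x),
        _root_.sub_apply, hnu x hx, fderiv_hemisphereFactor_self hx, sub_self])
    (fun x hx => by
      have := hlap x hx
      rw [hΔv]
      simp only [laplacian_hemisphereFactor, hsphere x hx]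
      norm_num
      linarith)
    (fun x hx => by
      rw [hemisphereHeight, hsphere x hx]
      norm_num)
    (fun x _ i => partialDeriv_hemisphereHeight_mul_nonpos x i)
  set J : EuclideanSpace ℝ (Fin 4) → ℝ := fun x =>
    hemisphereHeight x * laplacian (laplacian v) x
      - v x * laplacian (laplacian hemisphereHeight) x with hJ_def
  have hJcont : Continuous J :=
    ((hφ.mul hv.laplacian.laplacian).sub (hv.mul hφ.laplacian.laplacian)).continuous
  have hJ : ∀ x ∈ ball (0 : EuclideanSpace ℝ (Fin 4)) 1,
      6 * hemisphereHeight x * exp (4 * hemisphereFactor x) * (exp (4 * v x) - (4 * v x + 1))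
        ≤ J x := by
    intro x hx
    have hexp : exp (4 * u x) = exp (4 * hemisphereFactor x) * exp (4 * v x) := by
      rw [← exp_add]
      congr 1
      simp only [hv_def]
      ring
    have h := hineq x hx
    rw [hexp] at h
    simp only [hJ_def, hΔΔv, bilaplacian_hemisphereHeight, bilaplacian_hemisphereFactor]
    nlinarith [mul_le_mul_of_nonneg_left h (hemisphereHeight_pos hx).le]
  have hJnonneg : ∀ x ∈ ball (0 : EuclideanSpace ℝ (Fin 4)) 1, 0 ≤ J x := fun x hx =>
    le_trans (mul_nonneg (by have := hemisphereHeight_pos hx; positivity)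
      (sub_nonneg.mpr (add_one_le_exp _))) (hJ x hx)
  have hJzero : Set.EqOn J 0 (ball 0 1) := by
    have hint : IntegrableOn J (ball 0 1) :=
      (hJcont.continuousOn.integrableOn_compact (isCompact_closedBall 0 1)).mono_set
        ball_subset_closedBall
    have hnn : 0 ≤ᵐ[volume.restrict (ball 0 1)] J :=
      (ae_restrict_iff' measurableSet_ball).mpr (.of_forall hJnonneg)
    have h0 : ∫ x in ball 0 1, J x = 0 :=
      le_antisymm hgreen (setIntegral_nonneg measurableSet_ball hJnonneg)
    exact Measure.eqOn_open_of_ae_eq ((setIntegral_eq_zero_iff_of_nonneg_ae hnn hint).mp h0)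
      isOpen_ball hJcont.continuousOn continuousOn_const
  intro x hx
  have hvx : v x = 0 := by
    rcases (mem_closedBall_zero_iff.mp hx).lt_or_eq with h | h
    · have hxb : x ∈ ball (0 : EuclideanSpace ℝ (Fin 4)) 1 := mem_ball_zero_iff.mpr h
      by_contra hne
      have hpos : 0 < exp (4 * v x) - (4 * v x + 1) :=
        sub_pos.mpr (add_one_lt_exp (mul_ne_zero four_ne_zero hne))
      have hφx := hemisphereHeight_pos hxb
      have hle := hJ x hxb
      rw [hJzero hxb] at hle
      exact absurd hle (not_le.mpr (by positivity))
    · exact hv0 x (mem_sphere_zero_iff_norm.mpr h)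
  rw [log_div two_ne_zero (by positivity)]
  exact sub_eq_zero.mp hvx
end

section
/- Let v : [0,∞) → ℝ be a smooth function satisfying v''''(t) − 4v''(t) ≥ 6e^{4v(t)} for all t ≥ 0, with v(0) = 0, v'(0) = 0, v'(t) ≤ 0 for all t ≥ 0, and such that v'(t) → −1, v''(t) → 0, and v'''(t) → 0 as t → ∞. Then v''(0)² ≤ 1. -/
open Real Filter

/-- A differentiable function whose derivative has a negative limit at `+∞` tends to `-∞`. -/
lemma tendsto_atBot_of_tendsto_deriv_neg {f : ℝ → ℝ} {c : ℝ} (hf : Differentiable ℝ f)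
    (hc : c < 0) (hlim : Tendsto (deriv f) atTop (nhds c)) : Tendsto f atTop atBot := by
  obtain ⟨T, hT⟩ := eventually_atTop.1 (hlim.eventually_le_const (show c < c / 2 by linarith))
  have hline : Tendsto (fun t : ℝ => f T + c / 2 * (t - T)) atTop atBot :=
    tendsto_atBot_add_const_left _ _
      ((tendsto_atTop_add_const_right _ (-T) tendsto_id).const_mul_atTop_of_neg (by linarith))
  refine tendsto_atBot_mono' _ ?_ hline
  filter_upwards [eventually_ge_atTop T] with t ht
  have := (convex_Ici T).image_sub_le_mul_sub_of_deriv_le hf.continuous.continuousOn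
    hf.differentiableOn (fun x hx => hT x (interior_subset hx)) T Set.self_mem_Ici t ht ht
  linarith

lemma ContDiff.hasDerivAt_iterate_deriv {f : ℝ → ℝ} (hf : ContDiff ℝ (⊤ : ℕ∞) f) (n : ℕ)
    (t : ℝ) : HasDerivAt (deriv^[n] f) (deriv^[n + 1] f t) t := by
  rw [Function.iterate_succ_apply']
  exact ((hf.iterate_deriv n).differentiable (by simp) t).hasDerivAt

/-- The energy `v'''v' - (v'')²/2 - 2(v')² - (3/2)e^{4v}`, conserved by solutions of
`v'''' - 4v'' = 6e^{4v}`. -/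
noncomputable def energy (v : ℝ → ℝ) (t : ℝ) : ℝ :=
  deriv^[3] v t * deriv v t - 1 / 2 * deriv^[2] v t ^ 2 - 2 * deriv v t ^ 2
    - 3 / 2 * Real.exp (4 * v t)

lemma hasDerivAt_energy {v : ℝ → ℝ} (hv : ContDiff ℝ (⊤ : ℕ∞) v) (t : ℝ) :
    HasDerivAt (energy v)
      (deriv v t * (deriv^[4] v t - 4 * deriv^[2] v t - 6 * Real.exp (4 * v t))) t := by
  have d0 : HasDerivAt v (deriv v t) t := hv.hasDerivAt_iterate_deriv 0 t
  have d1 : HasDerivAt (deriv v) (deriv^[2] v t) t := hv.hasDerivAt_iterate_deriv 1 t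
  have d2 := hv.hasDerivAt_iterate_deriv 2 t
  have d3 := hv.hasDerivAt_iterate_deriv 3 t
  have d := (((d3.mul d1).sub ((d2.pow 2).const_mul (1 / 2))).sub
    ((d1.pow 2).const_mul 2)).sub ((d0.const_mul 4).exp.const_mul (3 / 2))
  refine HasDerivAt.congr_deriv (f := energy v) d ?_
  push_cast
  ring

lemma antitoneOn_energy {v : ℝ → ℝ} (hv : ContDiff ℝ (⊤ : ℕ∞) v)
    (hineq : ∀ t ≥ (0 : ℝ), deriv^[4] v t - 4 * deriv^[2] v t ≥ 6 * Real.exp (4 * v t))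
    (hmono : ∀ t ≥ (0 : ℝ), deriv v t ≤ 0) : AntitoneOn (energy v) (Set.Ici 0) := by
  refine antitoneOn_of_deriv_nonpos (convex_Ici 0)
    (fun t _ => (hasDerivAt_energy hv t).continuousAt.continuousWithinAt)
    (fun t _ => (hasDerivAt_energy hv t).differentiableAt.differentiableWithinAt) fun t ht => ?_
  have ht0 : 0 ≤ t := interior_subset ht
  rw [(hasDerivAt_energy hv t).deriv]
  exact mul_nonpos_of_nonpos_of_nonneg (hmono t ht0) (sub_nonneg.2 (hineq t ht0))

lemma tendsto_energy {v : ℝ → ℝ} (hv : Differentiable ℝ v)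
    (hlim1 : Tendsto (deriv v) atTop (nhds (-1)))
    (hlim2 : Tendsto (deriv^[2] v) atTop (nhds 0))
    (hlim3 : Tendsto (deriv^[3] v) atTop (nhds 0)) :
    Tendsto (energy v) atTop (nhds (-2)) := by
  have hexp : Tendsto (fun t => Real.exp (4 * v t)) atTop (nhds 0) :=
    Real.tendsto_exp_atBot.comp
      ((tendsto_atBot_of_tendsto_deriv_neg hv (by norm_num) hlim1).const_mul_atBot (by norm_num))
  convert (((hlim3.mul hlim1).sub ((hlim2.pow 2).const_mul (1 / 2))).sub
    ((hlim1.pow 2).const_mul 2)).sub (hexp.const_mul (3 / 2)) using 2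
  · rfl
  · norm_num

/-- An intermediate claim in the proof of Proposition 2.2 of the paper:
under the differential inequality and the stated boundary/asymptotic conditions,
`v''(0)² ≤ 1`. -/
theorem stmt_6 (v : ℝ → ℝ) (hv : ContDiff ℝ (⊤ : ℕ∞) v)
    (hineq : ∀ t ≥ (0 : ℝ),
      deriv^[4] v t - 4 * deriv^[2] v t ≥ 6 * Real.exp (4 * v t))
    (h0 : v 0 = 0) (h1 : deriv v 0 = 0)
    (hmono : ∀ t ≥ (0 : ℝ), deriv v t ≤ 0)
    (hlim1 : Tendsto (deriv v) atTop (nhds (-1)))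
    (hlim2 : Tendsto (deriv^[2] v) atTop (nhds 0))
    (hlim3 : Tendsto (deriv^[3] v) atTop (nhds 0)) :
    (deriv^[2] v 0) ^ 2 ≤ 1 := by
  have hle : -2 ≤ energy v 0 := by
    refine le_of_tendsto (tendsto_energy (hv.differentiable (by simp)) hlim1 hlim2 hlim3) ?_
    filter_upwards [eventually_ge_atTop 0] with t ht
    exact antitoneOn_energy hv hineq hmono Set.self_mem_Ici ht ht
  rw [energy, h0, h1, mul_zero, mul_zero, Real.exp_zero] at hle
  linarith
end
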